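/- Let E = ∏_p E_p ⊆ Ẑ be compact. The ℤ-module Int_ℚ(E, Ẑ) admits a regular basis (a ℤ-basis with exactly one polynomial of each degree) if and only if (1) E_p is infinite for every prime p, and (2) for each n ≥ 0, #(E_p mod p) > n for all but finitely many primes p. -/

import Mathlib

open Polynomial

instance (p : Nat.Primes) : Fact (p : ℕ).Prime := ⟨p.2⟩

/-- `Ẑ = ∏_p ℤ_p`, the profinite completion of `ℤ` (product model). -/
abbrev Zhat : Type := ∀ p : Nat.Primes, ℤ_[(p : ℕ)]

/-- `Int_ℚ(E, Ẑ) = {f ∈ ℚ[x] : f(α_p) ∈ ℤ_p for all (α_p)_p ∈ E and all primes p}`. -/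
def IntQ (E : Set Zhat) : Set (Polynomial ℚ) :=
  {f | ∀ α ∈ E, ∀ p : Nat.Primes, ‖(Polynomial.aeval ((α p : ℚ_[(p : ℕ)]))) f‖ ≤ 1}

/-- `Int_ℚ(E_p, ℤ_p) = {f ∈ ℚ[x] : f(E_p) ⊆ ℤ_p}`. -/
def IntQp (p : Nat.Primes) (S : Set ℤ_[(p : ℕ)]) : Set (Polynomial ℚ) :=
  {f | ∀ x ∈ S, ‖(Polynomial.aeval ((x : ℚ_[(p : ℕ)]))) f‖ ≤ 1}
/-- The `n`-th characteristic `ℤ`-module of `Int_ℚ(E, Ẑ)`: leading coefficients of its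
elements of degree `≤ n` (with `lc 0 = 0` by convention). -/
def In (E : Set Zhat) (n : ℕ) : Set ℚ :=
  {c | ∃ f ∈ IntQ E, f.degree ≤ (n : ℕ) ∧ f.leadingCoeff = c}

/-- The `n`-th characteristic module of `Int_ℚ(E_p, ℤ_p)`. -/
def Inp (p : Nat.Primes) (S : Set ℤ_[(p : ℕ)]) (n : ℕ) : Set ℚ :=
  {c | ∃ f ∈ IntQp p S, f.degree ≤ (n : ℕ) ∧ f.leadingCoeff = c}

/-- A *regular basis* of the `ℤ`-module `Int_ℚ(E, Ẑ)`: a sequence of integer-valued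
polynomials with `deg f_n = n` such that every element of `Int_ℚ(E, Ẑ)` is a unique finite
`ℤ`-linear combination of the `f_n`. -/
def IsRegularBasis (E : Set Zhat) (f : ℕ → Polynomial ℚ) : Prop :=
  (∀ n, f n ∈ IntQ E ∧ (f n).degree = (n : ℕ)) ∧
    ∀ g ∈ IntQ E, ∃! c : ℕ →₀ ℤ, g = c.sum fun n a => a • f n

lemma coe_finset_prod {p : ℕ} [Fact p.Prime] {ι : Type*} (s : Finset ι) (f : ι → ℤ_[p]) :
    ((∏ i ∈ s, f i : ℤ_[p]) : ℚ_[p]) = ∏ i ∈ s, (f i : ℚ_[p]) :=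
  map_prod PadicInt.Coe.ringHom f s

lemma pi_nonempty_of_infinite {Ep : ∀ p : Nat.Primes, Set ℤ_[(p : ℕ)]}
    (h : ∀ p, (Ep p).Infinite) : (Set.univ.pi Ep).Nonempty :=
  Set.univ_pi_nonempty_iff.mpr fun p => (h p).nonempty

lemma mem_IntQp_of_mem_IntQ_pi {Ep : ∀ p : Nat.Primes, Set ℤ_[(p : ℕ)]}
    (h : (Set.univ.pi Ep).Nonempty) {f : ℚ[X]} (hf : f ∈ IntQ (Set.univ.pi Ep))
    (p : Nat.Primes) : f ∈ IntQp p (Ep p) := by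
  classical
  obtain ⟨α, hα⟩ := h
  intro x hx
  have hmem : Function.update α p x ∈ Set.univ.pi Ep := by
    intro q _
    by_cases hq : q = p
    · subst hq; simpa using hx
    · simpa [hq] using hα q trivial
  simpa using hf _ hmem p

lemma sub_mem_IntQ {E : Set Zhat} {f g : ℚ[X]} (hf : f ∈ IntQ E) (hg : g ∈ IntQ E) :
    f - g ∈ IntQ E := by
  intro α hα p
  have h := (PadicInt.subring (p : ℕ)).sub_mem (hf α hα p) (hg α hα p)
  rw [map_sub]
  exact h

lemma zsmul_mem_IntQ {E : Set Zhat} {f : ℚ[X]} (hf : f ∈ IntQ E) (m : ℤ) :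
    m • f ∈ IntQ E := by
  intro α hα p
  have h := (PadicInt.subring (p : ℕ)).zsmul_mem (hf α hα p) m
  rw [map_zsmul]
  exact h

lemma zero_mem_IntQ (E : Set Zhat) : (0 : ℚ[X]) ∈ IntQ E := by
  intro α _ p
  simp

lemma X_pow_mem_IntQ (E : Set Zhat) (n : ℕ) : (X ^ n : ℚ[X]) ∈ IntQ E := by
  intro α _ p
  have h := PadicInt.norm_le_one ((α p) ^ n)
  simpa using h

/-- A rational number which is a `p`-adic integer for every prime `p` is an integer. -/
lemma exists_int_eq_of_padic_norm_le_one {q : ℚ}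
    (h : ∀ p : Nat.Primes, ‖(q : ℚ_[(p : ℕ)])‖ ≤ 1) : ∃ m : ℤ, (m : ℚ) = q := by
  refine ⟨q.num, Rat.coe_int_num_of_den_eq_one ?_⟩
  by_contra hden
  obtain ⟨p, hp, hpd⟩ := Nat.exists_prime_and_dvd hden
  have : Fact p.Prime := ⟨hp⟩
  have hq : ‖(q : ℚ_[p])‖ ≤ 1 := h ⟨p, hp⟩
  have hmul : ((q : ℚ_[p])) * ((q.den : ℤ) : ℚ_[p]) = ((q.num : ℤ) : ℚ_[p]) := by
    have := Rat.mul_den_eq_num q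
    exact_mod_cast congrArg (Rat.cast : ℚ → ℚ_[p]) this
  have hd : ‖((q.den : ℤ) : ℚ_[p])‖ < 1 :=
    (Padic.norm_intCast_lt_one_iff).mpr (by exact_mod_cast hpd)
  have hn : ‖((q.num : ℤ) : ℚ_[p])‖ < 1 := by
    rw [← hmul, norm_mul]
    exact (mul_le_of_le_one_left (norm_nonneg _) hq).trans_lt hd
  have hdvd := (Padic.norm_intCast_lt_one_iff).mp hn
  have hcop := q.reduced
  have h1 : p ∣ q.num.natAbs := Int.natCast_dvd.mp hdvd
  have := Nat.dvd_gcd h1 hpd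
  rw [hcop] at this
  exact hp.one_lt.ne' (Nat.dvd_one.mp this)

open Classical in
/-- Lagrange interpolation at the nodes `s` bounds the denominator at `p` of the coefficient of
degree `#s - 1`. -/
lemma norm_pow_mul_coeff_le_one {p : Nat.Primes} {S : Set ℤ_[(p : ℕ)]} {n : ℕ}
    {s : Finset ℤ_[(p : ℕ)]} (hs : ↑s ⊆ S) (hcard : s.card = n + 1) {e : ℕ}
    (he : ∀ x ∈ s, ‖((p : ℕ) : ℚ_[(p : ℕ)]) ^ e‖ ≤
      ‖∏ y ∈ s.erase x, ((x : ℚ_[(p : ℕ)]) - (y : ℚ_[(p : ℕ)]))‖)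
    {f : ℚ[X]} (hf : f ∈ IntQp p S) (hdeg : f.degree ≤ n) :
    ‖((p : ℕ) : ℚ_[(p : ℕ)]) ^ e * (f.coeff n : ℚ_[(p : ℕ)])‖ ≤ 1 := by
  have hinj : Set.InjOn (fun x : ℤ_[(p : ℕ)] => (x : ℚ_[(p : ℕ)])) s :=
    Subtype.val_injective.injOn
  have hlt : (f.map (algebraMap ℚ ℚ_[(p : ℕ)])).degree < s.card := by
    rw [hcard, degree_map]
    exact hdeg.trans_lt (by exact_mod_cast n.lt_succ_self)
  have hc := Lagrange.coeff_eq_sum hinj hlt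
  rw [hcard, Nat.add_sub_cancel, coeff_map, eq_ratCast] at hc
  rw [hc, Finset.mul_sum]
  refine IsUltrametricDist.norm_sum_le_of_forall_le_of_nonneg zero_le_one fun x hx => ?_
  have hfx := hf x (hs hx)
  rw [eval_map_algebraMap, mul_div_left_comm, norm_mul, norm_div]
  exact mul_le_one₀ hfx (by positivity) (div_le_one_of_le₀ (he x hx) (norm_nonneg _))

lemma norm_sub_eq_one_of_toZMod_ne {p : ℕ} [Fact p.Prime] {x y : ℤ_[p]}
    (h : PadicInt.toZMod x ≠ PadicInt.toZMod y) : ‖(x : ℚ_[p]) - (y : ℚ_[p])‖ = 1 := by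
  have hxy : x - y ∉ IsLocalRing.maximalIdeal ℤ_[p] := by
    rw [← PadicInt.ker_toZMod, RingHom.mem_ker, map_sub, sub_eq_zero]
    exact h
  have hu : IsUnit (x - y) := by simpa using hxy
  rw [← PadicInt.coe_sub, PadicInt.padic_norm_e_of_padicInt]
  exact PadicInt.isUnit_iff.mp hu

lemma exists_pow_norm_mul_coeff_le_one {p : Nat.Primes} {S : Set ℤ_[(p : ℕ)]}
    (hS : S.Infinite) (n : ℕ) :
    ∃ e : ℕ, (n < (PadicInt.toZMod '' S).ncard → e = 0) ∧
      ∀ f ∈ IntQp p S, f.degree ≤ n →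
        ‖((p : ℕ) : ℚ_[(p : ℕ)]) ^ e * (f.coeff n : ℚ_[(p : ℕ)])‖ ≤ 1 := by
  classical
  by_cases hn : n < (PadicInt.toZMod '' S).ncard
  · obtain ⟨t, ht, htc⟩ := Set.exists_subset_card_eq (Nat.succ_le_of_lt hn)
    have htf : t.Finite := Set.toFinite t
    obtain ⟨u, huS, hut⟩ := Set.SurjOn.exists_bijOn_subset
      (f := (PadicInt.toZMod : ℤ_[(p : ℕ)] → _)) ht
    have huf : u.Finite := hut.finite_iff_finite.mpr htf
    refine ⟨0, fun _ => rfl, fun f hf hdeg => ?_⟩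
    refine norm_pow_mul_coeff_le_one (s := huf.toFinset) (by simpa using huS) ?_ ?_ hf hdeg
    · rw [← Set.ncard_eq_toFinset_card u huf, ← hut.injOn.ncard_image,
        hut.image_eq, htc]
    · intro x hx
      rw [norm_prod, Finset.prod_eq_one]
      · simp
      · intro y hy
        rw [Finset.mem_erase, Set.Finite.mem_toFinset] at hy
        rw [Set.Finite.mem_toFinset] at hx
        exact norm_sub_eq_one_of_toZMod_ne fun h => hy.1 (hut.injOn hx hy.2 h).symm
  · obtain ⟨s, hs, hcard⟩ := hS.exists_subset_card_eq (n + 1)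
    have hlim : Filter.Tendsto (fun e : ℕ => ‖((p : ℕ) : ℚ_[(p : ℕ)]) ^ e‖)
        Filter.atTop (nhds 0) := by
      simp only [norm_pow]
      exact tendsto_pow_atTop_nhds_zero_of_lt_one (norm_nonneg _) Padic.norm_p_lt_one
    have hev : ∀ᶠ e : ℕ in Filter.atTop, ∀ x ∈ s, ‖((p : ℕ) : ℚ_[(p : ℕ)]) ^ e‖ ≤
        ‖∏ y ∈ s.erase x, ((x : ℚ_[(p : ℕ)]) - (y : ℚ_[(p : ℕ)]))‖ := by
      rw [Filter.eventually_all_finset]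
      intro x _
      refine hlim.eventually_le_const (norm_pos_iff.mpr (Finset.prod_ne_zero_iff.mpr ?_))
      intro y hy
      exact sub_ne_zero.mpr fun h => Finset.ne_of_mem_erase hy (Subtype.ext h).symm
    obtain ⟨e, he⟩ := hev.exists
    exact ⟨e, fun h => absurd h hn, fun f hf hdeg =>
      norm_pow_mul_coeff_le_one hs hcard he hf hdeg⟩

lemma exists_common_denominator {Ep : ∀ p : Nat.Primes, Set ℤ_[(p : ℕ)]}
    (hinf : ∀ p, (Ep p).Infinite) (n : ℕ)
    (hfin : {p : Nat.Primes | ¬ n < (PadicInt.toZMod '' Ep p).ncard}.Finite) :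
    ∃ D : ℕ, D ≠ 0 ∧ ∀ f ∈ IntQ (Set.univ.pi Ep), f.degree ≤ n →
      ∃ m : ℤ, (m : ℚ) = D * f.coeff n := by
  classical
  choose e he0 he using fun p => exists_pow_norm_mul_coeff_le_one (hinf p) n
  refine ⟨∏ p ∈ hfin.toFinset, (p : ℕ) ^ e p,
    Finset.prod_ne_zero_iff.mpr fun p _ => pow_ne_zero _ p.2.ne_zero, fun f hf hdeg => ?_⟩
  refine exists_int_eq_of_padic_norm_le_one fun q => ?_
  have hq := he q f (mem_IntQp_of_mem_IntQ_pi (pi_nonempty_of_infinite hinf) hf q) hdeg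
  have hdvd : (q : ℕ) ^ e q ∣ ∏ p ∈ hfin.toFinset, (p : ℕ) ^ e p := by
    by_cases hmem : q ∈ hfin.toFinset
    · exact Finset.dvd_prod_of_mem (fun p : Nat.Primes => (p : ℕ) ^ e p) hmem
    · rw [he0 q (by simpa using hmem), pow_zero]
      exact one_dvd _
  obtain ⟨k, hk⟩ := hdvd
  rw [hk]
  push_cast
  rw [mul_right_comm, norm_mul]
  exact mul_le_one₀ hq (norm_nonneg _) (by exact_mod_cast Padic.norm_int_le_one (p := q) (k : ℤ))

lemma exists_generator {Ep : ∀ p : Nat.Primes, Set ℤ_[(p : ℕ)]}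
    (hinf : ∀ p, (Ep p).Infinite) (n : ℕ)
    (hfin : {p : Nat.Primes | ¬ n < (PadicInt.toZMod '' Ep p).ncard}.Finite) :
    ∃ f ∈ IntQ (Set.univ.pi Ep), f.degree = n ∧ ∀ g ∈ IntQ (Set.univ.pi Ep), g.degree ≤ n →
      ∃ m : ℤ, g.coeff n = m * f.coeff n := by
  obtain ⟨D, hD, hden⟩ := exists_common_denominator hinf n hfin
  have hDQ : (D : ℚ) ≠ 0 := by exact_mod_cast hD
  let H : AddSubgroup ℤ := AddSubgroup.ofSub
    {m : ℤ | ∃ f ∈ IntQ (Set.univ.pi Ep), f.degree ≤ n ∧ (m : ℚ) = D * f.coeff n}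
    ⟨0, 0, zero_mem_IntQ _, by simp, by simp⟩ (by
      rintro a ⟨f, hf, hfd, hfa⟩ b ⟨g, hg, hgd, hgb⟩
      refine ⟨f - g, sub_mem_IntQ hf hg, (degree_sub_le _ _).trans (max_le hfd hgd), ?_⟩
      push_cast
      rw [coeff_sub, hfa, hgb]
      ring)
  obtain ⟨a, ha⟩ := Int.subgroup_cyclic H
  have haH : a ∈ H := by rw [ha]; exact AddSubgroup.mem_closure_singleton_self a
  have hDH : (D : ℤ) ∈ H := ⟨X ^ n, X_pow_mem_IntQ _ n, by simp, by simp⟩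
  obtain ⟨f, hf, hfd, hfa⟩ := haH
  have ha0 : a ≠ 0 := by
    rintro rfl
    rw [ha, AddSubgroup.mem_closure_singleton] at hDH
    obtain ⟨k, hk⟩ := hDH
    rw [smul_zero] at hk
    exact hD (by exact_mod_cast hk.symm)
  have hfc : f.coeff n ≠ 0 := by
    intro h
    rw [h, mul_zero] at hfa
    exact ha0 (by exact_mod_cast hfa)
  refine ⟨f, hf, le_antisymm hfd (le_degree_of_ne_zero hfc), fun g hg hgd => ?_⟩
  obtain ⟨m, hm⟩ := hden g hg hgd
  have hmH : m ∈ H := ⟨g, hg, hgd, hm⟩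
  rw [ha, AddSubgroup.mem_closure_singleton] at hmH
  obtain ⟨k, rfl⟩ := hmH
  refine ⟨k, mul_left_cancel₀ hDQ ?_⟩
  rw [← hm, mul_left_comm, ← hfa]
  simp

lemma isRegularBasis_of_coeff {E : Set Zhat} {f : ℕ → ℚ[X]} (hf : ∀ n, f n ∈ IntQ E)
    (hdeg : ∀ n, (f n).degree = n)
    (hgen : ∀ n : ℕ, ∀ g ∈ IntQ E, g.degree ≤ n → ∃ m : ℤ, g.coeff n = m * (f n).coeff n) :
    IsRegularBasis E f := by
  refine ⟨fun n => ⟨hf n, hdeg n⟩, fun g hg => ?_⟩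
  have hli : LinearIndependent ℤ f :=
    LinearIndependent.restrict_scalars (R := ℤ) (K := ℚ)
      (by intro a b hab; simpa using hab) (Sequence.linearIndependent ⟨f, hdeg⟩)
  have hspan : ∀ n : ℕ, ∀ g ∈ IntQ E, g.degree < n →
      g ∈ Submodule.span ℤ (Set.range f) := by
    intro n
    induction n with
    | zero =>
      intro g _ hgd
      rw [show g = 0 by simpa using hgd]
      exact zero_mem _
    | succ n ih =>
      intro g hg hgd
      have hgd' : g.degree ≤ n := by
        rw [degree_le_iff_coeff_zero]
        intro k hk
        exact (degree_lt_iff_coeff_zero _ _).mp hgd k (by exact_mod_cast hk)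
      obtain ⟨m, hm⟩ := hgen n g hg hgd'
      have hr : g - m • f n ∈ Submodule.span ℤ (Set.range f) := by
        refine ih _ (sub_mem_IntQ hg (zsmul_mem_IntQ (hf n) m)) ?_
        rw [degree_lt_iff_coeff_zero]
        intro k hk
        rcases hk.eq_or_lt with rfl | hlt
        · simp [hm]
        · rw [coeff_sub, coeff_smul,
            coeff_eq_zero_of_degree_lt (hgd'.trans_lt (by exact_mod_cast hlt)),
            coeff_eq_zero_of_degree_lt (p := f n) (by rw [hdeg]; exact_mod_cast hlt)]
          simp
      have := add_mem hr (Submodule.smul_mem _ m (Submodule.subset_span ⟨n, rfl⟩))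
      simpa using this
  obtain ⟨c, hc⟩ := Finsupp.mem_span_range_iff_exists_finsupp.mp
    (hspan (g.natDegree + 1) g hg
      (degree_le_natDegree.trans_lt (by exact_mod_cast g.natDegree.lt_succ_self)))
  refine ⟨c, hc.symm, fun c' hc' => hli ?_⟩
  rw [Finsupp.linearCombination_apply, Finsupp.linearCombination_apply]
  exact hc'.symm.trans hc.symm

lemma IsRegularBasis.coeff_ne_zero {E : Set Zhat} {f : ℕ → ℚ[X]} (h : IsRegularBasis E f)
    (n : ℕ) : (f n).coeff n ≠ 0 :=
  coeff_ne_zero_of_eq_degree (h.1 n).2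

lemma IsRegularBasis.exists_coeff_eq {E : Set Zhat} {f : ℕ → ℚ[X]} (h : IsRegularBasis E f)
    {n : ℕ} {g : ℚ[X]} (hg : g ∈ IntQ E) (hgd : g.degree ≤ n) :
    ∃ m : ℤ, g.coeff n = m * (f n).coeff n := by
  obtain ⟨c, hc, -⟩ := h.2 g hg
  have hcoeff : ∀ N, (∀ i ∈ c.support, i ≤ N) → g.coeff N = c N * (f N).coeff N := by
    intro N hN
    rw [hc, Finsupp.sum, finsetSum_coeff, Finset.sum_eq_single N]
    · simp
    · intro i hi hiN
      rw [coeff_smul, coeff_eq_zero_of_degree_lt, smul_zero]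
      rw [(h.1 i).2]
      exact_mod_cast lt_of_le_of_ne (hN i hi) hiN
    · intro hN
      simp [Finsupp.notMem_support_iff.mp hN]
  refine ⟨c n, hcoeff n fun i hi => ?_⟩
  by_contra! hlt
  have hne : c.support.Nonempty := ⟨i, hi⟩
  have hmax := c.support.max'_mem hne
  have hle := c.support.le_max' i hi
  have hz := hcoeff (c.support.max' hne) fun j hj => c.support.le_max' j hj
  rw [coeff_eq_zero_of_degree_lt (hgd.trans_lt (by exact_mod_cast hlt.trans_le hle))] at hz
  rcases mul_eq_zero.mp hz.symm with h0 | h0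
  · exact Finsupp.mem_support_iff.mp hmax (by exact_mod_cast h0)
  · exact h.coeff_ne_zero _ h0

/-- If `n` residue classes mod `p ^ k` cover `E_p`, then `Int_ℚ(E, Ẑ)` contains a polynomial of
degree `n` with leading coefficient `p ^ (-k)`. -/
lemma exists_mem_IntQ_coeff_eq_inv {Ep : ∀ p : Nat.Primes, Set ℤ_[(p : ℕ)]} (p : Nat.Primes)
    (k n : ℕ) (T : Finset ℕ) (hT : T.card ≤ n)
    (hcov : ∀ x ∈ Ep p, ∃ t ∈ T, ((p : ℕ) : ℤ_[(p : ℕ)]) ^ k ∣ x - t) :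
    ∃ g ∈ IntQ (Set.univ.pi Ep), g.degree ≤ n ∧ g.coeff n = (((p : ℕ) : ℚ) ^ k)⁻¹ := by
  let P : ℚ[X] := (∏ t ∈ T, (X - C (t : ℚ))) * X ^ (n - T.card)
  have hmonic : P.Monic := (monic_prod_X_sub_C _ _).mul (monic_X_pow _)
  have hnat : P.natDegree = n := by
    rw [(monic_prod_X_sub_C _ _).natDegree_mul (monic_X_pow _), natDegree_X_pow,
      natDegree_finsetProd_X_sub_C_eq_card]
    omega
  have hP : ∀ (q : Nat.Primes) (x : ℤ_[(q : ℕ)]), aeval (x : ℚ_[(q : ℕ)]) P =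
      (((∏ t ∈ T, (x - t)) * x ^ (n - T.card) : ℤ_[(q : ℕ)]) : ℚ_[(q : ℕ)]) := by
    intro q x
    rw [PadicInt.coe_mul, coe_finset_prod]
    simp [P, map_prod]
  refine ⟨C ((((p : ℕ) : ℚ) ^ k)⁻¹) * P, fun α hα q => ?_, ?_, ?_⟩
  · rw [map_mul, aeval_C, hP, norm_mul]
    by_cases hq : q = p
    · subst hq
      obtain ⟨t, ht, hdvd⟩ := hcov (α q) (hα q trivial)
      obtain ⟨z, hz⟩ := (hdvd.trans (Finset.dvd_prod_of_mem (fun t : ℕ => α q - t) ht)).mul_right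
        ((α q) ^ (n - T.card))
      have hp0 : ((q : ℕ) : ℚ_[(q : ℕ)]) ≠ 0 := by exact_mod_cast q.2.ne_zero
      rw [hz, ← norm_mul]
      have : (algebraMap ℚ ℚ_[(q : ℕ)]) ((((q : ℕ) : ℚ) ^ k)⁻¹) *
          ((((q : ℕ) : ℤ_[(q : ℕ)]) ^ k * z : ℤ_[(q : ℕ)]) : ℚ_[(q : ℕ)]) = z := by
        push_cast
        simp [hp0]
      rw [this]
      exact z.norm_le_one
    · have hunit : ‖((p : ℕ) : ℚ_[(q : ℕ)])‖ = 1 := by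
        rw [Padic.norm_natCast_eq_one_iff]
        exact (Nat.coprime_primes q.2 p.2).mpr fun h => hq (Subtype.ext h)
      refine mul_le_one₀ (le_of_eq ?_) (norm_nonneg _) (PadicInt.norm_le_one _)
      simp [hunit]
  · refine degree_le_of_natDegree_le ((natDegree_C_mul_le _ _).trans hnat.le)
  · rw [coeff_C_mul, ← hnat, hmonic.coeff_natDegree, mul_one]

lemma IsRegularBasis.exists_dvd {Ep : ∀ p : Nat.Primes, Set ℤ_[(p : ℕ)]} {f : ℕ → ℚ[X]}
    (h : IsRegularBasis (Set.univ.pi Ep) f) (n : ℕ) :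
    ∃ d : ℤ, d ≠ 0 ∧ ∀ (p : Nat.Primes) (k : ℕ) (T : Finset ℕ), T.card ≤ n →
      (∀ x ∈ Ep p, ∃ t ∈ T, ((p : ℕ) : ℤ_[(p : ℕ)]) ^ k ∣ x - t) → ((p : ℕ) : ℤ) ^ k ∣ d := by
  obtain ⟨d, hd⟩ := h.exists_coeff_eq (X_pow_mem_IntQ _ n) (degree_X_pow_le n)
  rw [coeff_X_pow_self] at hd
  have hc := h.coeff_ne_zero n
  refine ⟨d, ?_, fun p k T hT hcov => ?_⟩
  · rintro rfl
    simp at hd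
  · obtain ⟨g, hg, hgd, hgc⟩ := exists_mem_IntQ_coeff_eq_inv p k n T hT hcov
    obtain ⟨m, hm⟩ := h.exists_coeff_eq hg hgd
    have hp0 : (((p : ℕ) : ℚ) ^ k) ≠ 0 := pow_ne_zero _ (by exact_mod_cast p.2.ne_zero)
    refine ⟨m, ?_⟩
    have : (d : ℚ) = ((p : ℕ) : ℚ) ^ k * m := by
      refine mul_right_cancel₀ hc ?_
      rw [← hd, mul_assoc, ← hm, hgc, mul_inv_cancel₀ hp0]
    exact_mod_cast this

lemma IsRegularBasis.infinite {Ep : ∀ p : Nat.Primes, Set ℤ_[(p : ℕ)]} {f : ℕ → ℚ[X]}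
    (h : IsRegularBasis (Set.univ.pi Ep) f) (p : Nat.Primes) : (Ep p).Infinite := by
  classical
  intro hfin
  obtain ⟨d, hd, hdvd⟩ := h.exists_dvd hfin.toFinset.card
  have hall : ∀ k : ℕ, ((p : ℕ) : ℤ) ^ k ∣ d := fun k =>
    hdvd p k (hfin.toFinset.image fun x => x.appr k) Finset.card_image_le fun x hx =>
      ⟨x.appr k, Finset.mem_image_of_mem _ (hfin.mem_toFinset.mpr hx),
        Ideal.mem_span_singleton.mp (PadicInt.appr_spec k x)⟩
  have hfm : FiniteMultiplicity ((p : ℕ) : ℤ) d :=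
    Int.finiteMultiplicity_iff.mpr ⟨by simpa using p.2.one_lt.ne', hd⟩
  obtain ⟨k, hk⟩ := hfm
  exact hk (hall _)

lemma IsRegularBasis.finite_setOf_ncard_le {Ep : ∀ p : Nat.Primes, Set ℤ_[(p : ℕ)]}
    {f : ℕ → ℚ[X]} (h : IsRegularBasis (Set.univ.pi Ep) f) (n : ℕ) :
    {p : Nat.Primes | ¬ n < (PadicInt.toZMod '' Ep p).ncard}.Finite := by
  classical
  obtain ⟨d, hd, hdvd⟩ := h.exists_dvd n
  have hsub : {p : Nat.Primes | ¬ n < (PadicInt.toZMod '' Ep p).ncard} ⊆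
      (Subtype.val : Nat.Primes → ℕ) ⁻¹' ↑(d.natAbs.divisors) := by
    intro p hp
    have hfin : (PadicInt.toZMod '' Ep p).Finite := Set.toFinite _
    have hpd : ((p : ℕ) : ℤ) ^ 1 ∣ d := by
      refine hdvd p 1 (hfin.toFinset.image ZMod.val) ?_ fun x hx => ⟨x.zmodRepr, ?_, ?_⟩
      · rw [Set.mem_ofPred_eq, Set.ncard_eq_toFinset_card _ hfin] at hp
        exact Finset.card_image_le.trans (not_lt.mp hp)
      · rw [← PadicInt.val_toZMod_eq_zmodRepr]
        exact Finset.mem_image_of_mem _ (hfin.mem_toFinset.mpr ⟨x, hx, rfl⟩)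
      · have := PadicInt.sub_zmodRepr_mem x
        rw [pow_one]
        rwa [PadicInt.maximalIdeal_eq_span_p, Ideal.mem_span_singleton] at this
    rw [pow_one] at hpd
    exact Nat.mem_divisors.mpr ⟨Int.natCast_dvd.mp hpd, Int.natAbs_ne_zero.mpr hd⟩
  exact ((Finset.finite_toSet _).preimage Subtype.val_injective.injOn).subset hsub

/-- For compact `E = ∏_p E_p ⊆ Ẑ`, the `ℤ`-module `Int_ℚ(E, Ẑ)` admits a
regular basis iff (1) every `E_p` is infinite and (2) for each `n`, `#(E_p mod p) > n` for
all but finitely many `p`. -/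
theorem exists_regularBasis_iff (Ep : ∀ p : Nat.Primes, Set ℤ_[(p : ℕ)])
    (hcpt : IsCompact (Set.univ.pi Ep)) :
    (∃ f : ℕ → Polynomial ℚ, IsRegularBasis (Set.univ.pi Ep) f)
      ↔ ((∀ p, (Ep p).Infinite)
          ∧ ∀ n : ℕ, {p : Nat.Primes | ¬ n < (PadicInt.toZMod '' Ep p).ncard}.Finite) := by
  refine ⟨fun ⟨f, hf⟩ => ⟨hf.infinite, hf.finite_setOf_ncard_le⟩, fun ⟨hinf, hfin⟩ => ?_⟩
  choose f hf hdeg hgen using fun n => exists_generator hinf n (hfin n)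
  exact ⟨f, isRegularBasis_of_coeff hf hdeg hgen⟩
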